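/- Let K be a field, (A,▷,◁) a finite-dimensional special apre-perm algebra over K, and r ∈ A⊗A such that f(x)(r+τ(r)) = 0 and g(x)(r+τ(r)) = 0 for all x ∈ A. Then SA(r) = 0 if and only if for all a*,b* ∈ A*: r♯(a*)▷r♯(b*) = r♯( (L∘*+R∘*)(r♯(a*))(b*) + R▷*(r♯(b*))(a*) − (L∘*+R∘*)((r+τ(r))♯(a*))(b*) ) and r♯(a*)◁r♯(b*) = r♯( −R∘*(r♯(a*))(b*) − R∘*(r♯(b*))(a*) + R∘*((r+τ(r))♯(a*))(b*) ). -/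

import Mathlib

open TensorProduct

noncomputable section

namespace Paper

variable {K : Type*} [Field K]

section Defs

variable {A : Type*} [AddCommGroup A] [Module K A]
variable {V : Type*} [AddCommGroup V] [Module K V]

/-- Commutativity of a bilinear multiplication. -/
def IsComm (m : A →ₗ[K] A →ₗ[K] A) : Prop := ∀ x y, m x y = m y x

/-- Associativity of a bilinear multiplication. -/
def IsAssoc (m : A →ₗ[K] A →ₗ[K] A) : Prop := ∀ x y z, m (m x y) z = m x (m y z)

/-- `P` is an averaging operator on `(A, m)`. -/
def IsAveragingOp (m : A →ₗ[K] A →ₗ[K] A) (P : A →ₗ[K] A) : Prop :=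
  ∀ x y, m (P x) (P y) = P (m (P x) y) ∧ P (m (P x) y) = P (m x (P y))

/-- `(A, m, P, Q)` is an admissible averaging commutative algebra. -/
def IsAdmissibleAveraging (m : A →ₗ[K] A →ₗ[K] A) (P Q : A →ₗ[K] A) : Prop :=
  IsComm m ∧ IsAssoc m ∧ IsAveragingOp m P ∧
    ∀ x y, m (P x) (Q y) = Q (m (P x) y) ∧ Q (m (P x) y) = Q (m x (Q y))

/-- The flip `τ` on `A ⊗ A`. -/
def tau (r : A ⊗[K] A) : A ⊗[K] A := TensorProduct.comm K A A r

/-- The linear map `A* → A`, `a* ↦ r♯(a*)`, associated with `r ∈ A ⊗ A`,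
determined by `⟨r♯(a*), b*⟩ = ⟨r, a* ⊗ b*⟩`. -/
def sharp (r : A ⊗[K] A) : Module.Dual K A →ₗ[K] A :=
  (TensorProduct.lid K A).toLinearMap ∘ₗ LinearMap.applyₗ r ∘ₗ LinearMap.rTensorHom A

/-- `s ∈ A ⊗ A` is invariant on `(A, m)`:  `(id ⊗ L(x) - L(x) ⊗ id) s = 0` for all `x`. -/
def IsInvariant (m : A →ₗ[K] A →ₗ[K] A) (s : A ⊗[K] A) : Prop :=
  ∀ x : A, LinearMap.lTensor A (m x) s = LinearMap.rTensor A (m x) s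

/-- `(u⊗v)⊗(u'⊗v') ↦ b(u⊗u') ⊗ v ⊗ v'`. -/
def place1 (b : A ⊗[K] A →ₗ[K] A) :
    (A ⊗[K] A) ⊗[K] (A ⊗[K] A) →ₗ[K] A ⊗[K] (A ⊗[K] A) :=
  LinearMap.rTensor (A ⊗[K] A) b ∘ₗ (TensorProduct.tensorTensorTensorComm K A A A A).toLinearMap

/-- `(u⊗v)⊗(u'⊗v') ↦ u ⊗ b(v⊗u') ⊗ v'`. -/
def place2 (b : A ⊗[K] A →ₗ[K] A) :
    (A ⊗[K] A) ⊗[K] (A ⊗[K] A) →ₗ[K] A ⊗[K] (A ⊗[K] A) :=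
  LinearMap.lTensor A (LinearMap.rTensor A b) ∘ₗ
    LinearMap.lTensor A (TensorProduct.assoc K A A A).symm.toLinearMap ∘ₗ
      (TensorProduct.assoc K A A (A ⊗[K] A)).toLinearMap

/-- `(u⊗v)⊗(u'⊗v') ↦ u ⊗ u' ⊗ b(v⊗v')`. -/
def place3 (b : A ⊗[K] A →ₗ[K] A) :
    (A ⊗[K] A) ⊗[K] (A ⊗[K] A) →ₗ[K] A ⊗[K] (A ⊗[K] A) :=
  (TensorProduct.assoc K A A A).toLinearMap ∘ₗ LinearMap.lTensor (A ⊗[K] A) b ∘ₗ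
    (TensorProduct.tensorTensorTensorComm K A A A A).toLinearMap

/-- A bilinear multiplication as a linear map on the tensor square. -/
def liftM (m : A →ₗ[K] A →ₗ[K] A) : A ⊗[K] A →ₗ[K] A := TensorProduct.lift m

/-- The opposite multiplication as a linear map on the tensor square: `u ⊗ v ↦ m v u`. -/
def flipM (m : A →ₗ[K] A →ₗ[K] A) : A ⊗[K] A →ₗ[K] A :=
  TensorProduct.lift m ∘ₗ (TensorProduct.comm K A A).toLinearMap

/-- For `r = Σᵢ uᵢ ⊗ vᵢ`, the element
`𝐀(r) = Σᵢⱼ (uᵢ·uⱼ)⊗vᵢ⊗vⱼ − uᵢ⊗(uⱼ·vᵢ)⊗vⱼ + uᵢ⊗uⱼ⊗(vᵢ·vⱼ)` of `A⊗A⊗A`. -/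
def Acal (m : A →ₗ[K] A →ₗ[K] A) (r : A ⊗[K] A) : A ⊗[K] (A ⊗[K] A) :=
  place1 (liftM m) (r ⊗ₜ[K] r) - place2 (flipM m) (r ⊗ₜ[K] r) + place3 (liftM m) (r ⊗ₜ[K] r)

/-- `r` is a solution of the averaging associative Yang–Baxter equation (AAYBE) in
`(A, m, P, Q)`: `𝐀(r) = 0`, `(P⊗id − id⊗Q)(r) = 0` and `(Q⊗id − id⊗P)(r) = 0`. -/
def IsAAYBESolution (m : A →ₗ[K] A →ₗ[K] A) (P Q : A →ₗ[K] A) (r : A ⊗[K] A) : Prop :=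
  Acal m r = 0 ∧ LinearMap.rTensor A P r = LinearMap.lTensor A Q r ∧
    LinearMap.rTensor A Q r = LinearMap.lTensor A P r

/-- The co-multiplication `Δ_r : x ↦ (id ⊗ L(x) − L(x) ⊗ id)(r)`. -/
def DeltaMap (m : A →ₗ[K] A →ₗ[K] A) (r : A ⊗[K] A) : A →ₗ[K] A ⊗[K] A :=
  (LinearMap.applyₗ r ∘ₗ LinearMap.lTensorHom A) ∘ₗ m -
    (LinearMap.applyₗ r ∘ₗ LinearMap.rTensorHom A) ∘ₗ m

/-- The dual representation map `x ↦ (ρ(x))*`. -/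
def dualRep (ρ : A →ₗ[K] V →ₗ[K] V) : A →ₗ[K] Module.Dual K V →ₗ[K] Module.Dual K V :=
  Module.Dual.transpose ∘ₗ ρ

/-- `(ρ, α, β, V)` is a representation of the admissible averaging commutative algebra
`(A, m, P, Q)`. -/
def IsRep (m : A →ₗ[K] A →ₗ[K] A) (P Q : A →ₗ[K] A)
    (ρ : A →ₗ[K] V →ₗ[K] V) (α β : V →ₗ[K] V) : Prop :=
  (∀ x y v, ρ (m x y) v = ρ x (ρ y v)) ∧
  (∀ x v, ρ (P x) (α v) = α (ρ (P x) v) ∧ α (ρ (P x) v) = α (ρ x (α v))) ∧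
  (∀ x v, ρ (P x) (β v) = β (ρ (P x) v) ∧ β (ρ (P x) v) = β (ρ x (β v))) ∧
  (∀ x v, ρ (Q x) (α v) = β (ρ x (α v)) ∧ β (ρ x (α v)) = β (ρ (Q x) v))

/-- `(ρ, α, β, V, mV)` is an `(A, m, P, Q)`-representation algebra. -/
def IsRepAlg (m : A →ₗ[K] A →ₗ[K] A) (P Q : A →ₗ[K] A)
    (ρ : A →ₗ[K] V →ₗ[K] V) (α β : V →ₗ[K] V) (mV : V →ₗ[K] V →ₗ[K] V) : Prop :=
  IsRep m P Q ρ α β ∧ IsAdmissibleAveraging mV α β ∧ ∀ x u v, ρ x (mV u v) = mV (ρ x u) v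

/-- The semidirect-product multiplication on `A × V`:
`(x+u)·(y+v) = x·y + ρ(x)v + ρ(y)u + u ·_V v`. -/
def sdMul (m : A →ₗ[K] A →ₗ[K] A) (ρ : A →ₗ[K] V →ₗ[K] V) (mV : V →ₗ[K] V →ₗ[K] V) :
    (A × V) →ₗ[K] (A × V) →ₗ[K] (A × V) :=
  LinearMap.mk₂ K
    (fun p q => (m p.1 q.1, ρ p.1 q.2 + ρ q.1 p.2 + mV p.2 q.2))
    (fun p p' q => by
      simp only [Prod.fst_add, Prod.snd_add, map_add, LinearMap.add_apply, Prod.mk_add_mk,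
        Prod.mk.injEq]
      exact ⟨trivial, by abel⟩)
    (fun c p q => by
      simp only [Prod.smul_fst, Prod.smul_snd, map_smul, LinearMap.smul_apply, Prod.smul_mk,
        smul_add, Prod.mk.injEq])
    (fun p q q' => by
      simp only [Prod.fst_add, Prod.snd_add, map_add, LinearMap.add_apply, Prod.mk_add_mk,
        Prod.mk.injEq]
      exact ⟨trivial, by abel⟩)
    (fun c p q => by
      simp only [Prod.smul_fst, Prod.smul_snd, map_smul, LinearMap.smul_apply, Prod.smul_mk,
        smul_add, Prod.mk.injEq])

/-- Nondegeneracy of a bilinear form. -/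
def IsNondeg (B : A →ₗ[K] A →ₗ[K] K) : Prop := ∀ x, (∀ y, B x y = 0) → x = 0

/-- `(A, m, B)` is a symmetric Frobenius commutative algebra. -/
def IsSymFrob (m : A →ₗ[K] A →ₗ[K] A) (B : A →ₗ[K] A →ₗ[K] K) : Prop :=
  IsComm m ∧ IsAssoc m ∧ (∀ x y, B x y = B y x) ∧ IsNondeg B ∧
    ∀ x y z, B (m x y) z = B x (m y z)

/-- `R` is a Rota–Baxter operator of weight `l` on `(A, m)`. -/
def IsRB (m : A →ₗ[K] A →ₗ[K] A) (R : A →ₗ[K] A) (l : K) : Prop :=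
  ∀ x y, m (R x) (R y) = R (m (R x) y + m x (R y) + l • m x y)

/-- `(A, m, R, B)` is a symmetric Rota–Baxter Frobenius commutative algebra of weight `l`. -/
def IsSymRBFrob (m : A →ₗ[K] A →ₗ[K] A) (R : A →ₗ[K] A) (B : A →ₗ[K] A →ₗ[K] K) (l : K) :
    Prop :=
  IsSymFrob m B ∧ IsRB m R l ∧ ∀ x y, B (R x) y + B x (R y) + l • B x y = 0

/-- `(A, m, P, R, B)` is a symmetric averaging Rota–Baxter Frobenius commutative algebra of
weight `l`. -/
def IsSymAvgRBFrob (m : A →ₗ[K] A →ₗ[K] A) (P R : A →ₗ[K] A) (B : A →ₗ[K] A →ₗ[K] K)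
    (l : K) : Prop :=
  IsSymRBFrob m R B l ∧ IsAveragingOp m P ∧ P ∘ₗ R = R ∘ₗ P

/-- `(A, tr, lt)` is a special apre-perm algebra (with `x ▷ y = tr x y`, `x ◁ y = lt x y`). -/
def IsSAPP (tr lt : A →ₗ[K] A →ₗ[K] A) : Prop :=
  (∀ x y, lt x y = lt y x) ∧
  (∀ x y z, (tr + lt) x ((tr + lt) y z) = (tr + lt) ((tr + lt) x y) z ∧
      (tr + lt) ((tr + lt) x y) z = (tr + lt) ((tr + lt) y x) z) ∧
  (∀ x y z, lt ((tr + lt) x y) z = (tr + lt) x (lt y z) ∧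
      (tr + lt) x (lt y z) = - lt x (lt y z))

/-- `f(x) = id ⊗ R∘(x) + L◁(x) ⊗ id` on `A ⊗ A`. -/
def fmap (tr lt : A →ₗ[K] A →ₗ[K] A) (x : A) : A ⊗[K] A →ₗ[K] A ⊗[K] A :=
  LinearMap.lTensor A ((tr + lt).flip x) + LinearMap.rTensor A (lt x)

/-- `g(x) = L∘(x) ⊗ id − id ⊗ L∘(x)` on `A ⊗ A`. -/
def gmap (tr lt : A →ₗ[K] A →ₗ[K] A) (x : A) : A ⊗[K] A →ₗ[K] A ⊗[K] A :=
  LinearMap.rTensor A ((tr + lt) x) - LinearMap.lTensor A ((tr + lt) x)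

/-- For `r = Σᵢ uᵢ ⊗ vᵢ`, the element
`SA(r) = Σᵢⱼ (uᵢ∘uⱼ)⊗vᵢ⊗vⱼ + uᵢ⊗(vᵢ◁uⱼ)⊗vⱼ + uᵢ⊗uⱼ⊗(vⱼ∘vᵢ)` of `A⊗A⊗A`. -/
def SAcal (tr lt : A →ₗ[K] A →ₗ[K] A) (r : A ⊗[K] A) : A ⊗[K] (A ⊗[K] A) :=
  place1 (liftM (tr + lt)) (r ⊗ₜ[K] r) + place2 (liftM lt) (r ⊗ₜ[K] r) +
    place3 (flipM (tr + lt)) (r ⊗ₜ[K] r)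

/-- `(A, tr, lt, B)` is a quadratic special apre-perm algebra. -/
def IsQuadSAPP (tr lt : A →ₗ[K] A →ₗ[K] A) (B : A →ₗ[K] A →ₗ[K] K) : Prop :=
  IsSAPP tr lt ∧ (∀ x y, B x y = B y x) ∧ IsNondeg B ∧
    ∀ x y z, B (lt x y) z = - B x ((tr + lt) z y)

/-- `(A, tr, lt, R, B)` is a quadratic Rota–Baxter special apre-perm algebra of weight `l`. -/
def IsQuadRBSAPP (tr lt : A →ₗ[K] A →ₗ[K] A) (R : A →ₗ[K] A) (B : A →ₗ[K] A →ₗ[K] K)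
    (l : K) : Prop :=
  IsQuadSAPP tr lt B ∧ IsRB tr R l ∧ IsRB lt R l ∧
    ∀ x y, B (R x) y + B x (R y) + l • B x y = 0

/-- `x ◁ y = −Q(x·y)` as a bilinear map. -/
def ltOf (m : A →ₗ[K] A →ₗ[K] A) (Q : A →ₗ[K] A) : A →ₗ[K] A →ₗ[K] A :=
  - (LinearMap.llcomp K A A A Q ∘ₗ m)

/-- `x ▷ y = P(x)·y + Q(x·y)` as a bilinear map. -/
def trOf (m : A →ₗ[K] A →ₗ[K] A) (P Q : A →ₗ[K] A) : A →ₗ[K] A →ₗ[K] A :=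
  m ∘ₗ P + LinearMap.llcomp K A A A Q ∘ₗ m

/-- The multiplication `a* ◇_s b* = L*(s♯(a*))(b*)` on `A*`. -/
def diamondMap (m : A →ₗ[K] A →ₗ[K] A) (s : A ⊗[K] A) :
    Module.Dual K A →ₗ[K] Module.Dual K A →ₗ[K] Module.Dual K A :=
  dualRep m ∘ₗ sharp s

/-- The natural bilinear form `B_d(x+a*, y+b*) = ⟨a*, y⟩ + ⟨b*, x⟩` on `A × A*`. -/
def pairForm : (A × Module.Dual K A) →ₗ[K] (A × Module.Dual K A) →ₗ[K] K :=
  LinearMap.mk₂ K (fun p q => p.2 q.1 + q.2 p.1)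
    (fun p p' q => by
      simp only [Prod.fst_add, Prod.snd_add, LinearMap.add_apply, map_add]
      ring)
    (fun c p q => by
      simp only [Prod.smul_fst, Prod.smul_snd, LinearMap.smul_apply, map_smul, smul_eq_mul]
      ring)
    (fun p q q' => by
      simp only [Prod.fst_add, Prod.snd_add, LinearMap.add_apply, map_add]
      ring)
    (fun c p q => by
      simp only [Prod.smul_fst, Prod.smul_snd, LinearMap.smul_apply, map_smul, smul_eq_mul]
      ring)

/-- The Zinbiel and admissibility axioms for `(A, ⋆, P, Q)`. -/
def IsAdmAvgZinbiel (st : A →ₗ[K] A →ₗ[K] A) (P Q : A →ₗ[K] A) : Prop :=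
  (∀ x y z, st x (st y z) = st (st x y) z + st (st y x) z) ∧
  (∀ x y, st (P x) (P y) = P (st (P x) y) ∧ P (st (P x) y) = P (st x (P y))) ∧
  (∀ x y, Q (st (P x) y) = st (P x) (Q y) ∧ st (P x) (Q y) = Q (st x (Q y))) ∧
  (∀ x y, Q (st (Q x) y) = st (Q x) (P y) ∧ st (Q x) (P y) = Q (st x (P y)))

end Defs

end Paper

section Theorems

open Paper

variable {K : Type*} [Field K]
variable {A : Type*} [AddCommGroup A] [Module K A]
variable {V : Type*} [AddCommGroup V] [Module K V]

theorem sharp_tmul' (u v : A) (a : Module.Dual K A) : sharp (u ⊗ₜ[K] v) a = a u • v := by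
  simp [sharp]

theorem sharp_add' (r s : A ⊗[K] A) (a : Module.Dual K A) :
    sharp (r + s) a = sharp r a + sharp s a := by
  simp [sharp]

theorem tau_add' (r s : A ⊗[K] A) : tau (r + s) = tau r + tau s := by
  simp [tau]

theorem tau_tau' (r : A ⊗[K] A) : tau (tau r) = r := by
  simp [tau]

theorem sharp_zero' (a : Module.Dual K A) : sharp (0 : A ⊗[K] A) a = 0 := by
  simp [sharp]

theorem tau_zero' : tau (0 : A ⊗[K] A) = 0 := by
  simp [tau]

theorem tau_tmul' (u v : A) : tau (u ⊗ₜ[K] v) = v ⊗ₜ[K] u := by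
  simp [tau]

theorem sharp_adj (r : A ⊗[K] A) (a c : Module.Dual K A) :
    c (sharp r a) = a (sharp (tau r) c) := by
  induction r using TensorProduct.induction_on with
  | zero => simp [sharp_zero', tau_zero']
  | tmul u v => simp [sharp_tmul', tau_tmul', mul_comm]
  | add x y hx hy => simp [sharp_add', tau_add', hx, hy]

/-- Pairing with `a ⊗ b`. -/
def pair2 (a b : Module.Dual K A) : A ⊗[K] A →ₗ[K] K :=
  (TensorProduct.lid K K).toLinearMap ∘ₗ TensorProduct.map a b

/-- Pairing with `a ⊗ b ⊗ c`. -/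
def pair3 (a b c : Module.Dual K A) : A ⊗[K] (A ⊗[K] A) →ₗ[K] K :=
  (TensorProduct.lid K K).toLinearMap ∘ₗ TensorProduct.map a (pair2 b c)

theorem pair3_sep [FiniteDimensional K A] (t : A ⊗[K] (A ⊗[K] A))
    (h : ∀ a b c : Module.Dual K A, pair3 a b c t = 0) : t = 0 := by
  let B := Module.finBasis K A
  apply (B.tensorProduct (B.tensorProduct B)).ext_elem
  rintro ⟨i, j, k⟩
  have key : (B.tensorProduct (B.tensorProduct B)).coord (i, j, k) =
      pair3 (B.coord i) (B.coord j) (B.coord k) := by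
    ext x y z
    simp [pair3, pair2]; ring
  have h2 := LinearMap.congr_fun key t
  rw [h] at h2
  simpa using h2

theorem pair2_fmap (tr lt : A →ₗ[K] A →ₗ[K] A) (x : A) (s : A ⊗[K] A)
    (a b : Module.Dual K A) :
    pair2 a b (fmap tr lt x s) =
      b ((tr + lt) (sharp s a) x) + a (lt x (sharp (tau s) b)) := by
  induction s using TensorProduct.induction_on with
  | zero => simp [sharp_zero', tau_zero']
  | tmul u v => simp [sharp_tmul', tau_tmul', fmap, pair2]; ring
  | add p q hp hq =>
    simp only [map_add, sharp_add', tau_add', hp, hq, LinearMap.add_apply]; ring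

theorem pair3_place1 (m : A →ₗ[K] A →ₗ[K] A) (r s : A ⊗[K] A) (a b c : Module.Dual K A) :
    pair3 a b c (place1 (liftM m) (r ⊗ₜ[K] s)) =
      a (m (sharp (tau r) b) (sharp (tau s) c)) := by
  induction r using TensorProduct.induction_on with
  | zero => simp [sharp_zero', tau_zero']
  | add p q hp hq => simp [TensorProduct.add_tmul, sharp_add', tau_add', hp, hq]
  | tmul u v =>
    induction s using TensorProduct.induction_on with
    | zero => simp [sharp_zero', tau_zero']
    | add p q hp hq => simp only [TensorProduct.tmul_add, sharp_add', tau_add', hp, hq, map_add]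
    | tmul u' v' =>
      simp [sharp_tmul', tau_tmul', pair3, pair2, place1, Paper.liftM]; ring

theorem pair3_place2 (m : A →ₗ[K] A →ₗ[K] A) (r s : A ⊗[K] A) (a b c : Module.Dual K A) :
    pair3 a b c (place2 (liftM m) (r ⊗ₜ[K] s)) =
      b (m (sharp r a) (sharp (tau s) c)) := by
  induction r using TensorProduct.induction_on with
  | zero => simp [sharp_zero', tau_zero']
  | add p q hp hq => simp [TensorProduct.add_tmul, sharp_add', tau_add', hp, hq]
  | tmul u v =>
    induction s using TensorProduct.induction_on with
    | zero => simp [sharp_zero', tau_zero']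
    | add p q hp hq => simp only [TensorProduct.tmul_add, sharp_add', tau_add', hp, hq, map_add]
    | tmul u' v' =>
      simp [sharp_tmul', tau_tmul', pair3, pair2, place2, Paper.liftM]; ring

theorem pair3_place3 (m : A →ₗ[K] A →ₗ[K] A) (r s : A ⊗[K] A) (a b c : Module.Dual K A) :
    pair3 a b c (place3 (flipM m) (r ⊗ₜ[K] s)) =
      c (m (sharp s b) (sharp r a)) := by
  induction r using TensorProduct.induction_on with
  | zero => simp [sharp_zero', tau_zero']
  | add p q hp hq => simp [TensorProduct.add_tmul, sharp_add', tau_add', hp, hq]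
  | tmul u v =>
    induction s using TensorProduct.induction_on with
    | zero => simp [sharp_zero', tau_zero']
    | add p q hp hq =>
      simp only [TensorProduct.tmul_add, sharp_add', hp, hq, map_add, LinearMap.add_apply]
    | tmul u' v' =>
      simp [sharp_tmul', tau_tmul', pair3, pair2, place3, flipM]

theorem pair3_SAcal (tr lt : A →ₗ[K] A →ₗ[K] A) (r : A ⊗[K] A) (a b c : Module.Dual K A) :
    pair3 a b c (SAcal tr lt r) =
      a ((tr + lt) (sharp (tau r) b) (sharp (tau r) c)) +
      b (lt (sharp r a) (sharp (tau r) c)) + c ((tr + lt) (sharp r b) (sharp r a)) := by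
  rw [SAcal, map_add, map_add, pair3_place1, pair3_place2, pair3_place3]

theorem sappYBE_iff_Ooperator [FiniteDimensional K A]
    (tr lt : A →ₗ[K] A →ₗ[K] A) (hsapp : IsSAPP tr lt)
    (r : A ⊗[K] A)
    (hf : ∀ x : A, fmap tr lt x (r + tau r) = 0)
    (hg : ∀ x : A, gmap tr lt x (r + tau r) = 0) :
    SAcal tr lt r = 0 ↔
      ∀ a b : Module.Dual K A,
        (tr (sharp r a) (sharp r b) =
          sharp r (((tr + lt) (sharp r a)).dualMap b +
            ((tr + lt).flip (sharp r a)).dualMap b +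
            (tr.flip (sharp r b)).dualMap a -
            (((tr + lt) (sharp (r + tau r) a)).dualMap b +
              ((tr + lt).flip (sharp (r + tau r) a)).dualMap b))) ∧
        (lt (sharp r a) (sharp r b) =
          sharp r (-(((tr + lt).flip (sharp r a)).dualMap b) -
            ((tr + lt).flip (sharp r b)).dualMap a +
            ((tr + lt).flip (sharp (r + tau r) a)).dualMap b)) := by
  have hcomm := hsapp.1
  have F : ∀ (x : A) (a b : Module.Dual K A),
      b (tr (sharp r a) x) + b (lt (sharp r a) x) + b (tr (sharp (tau r) a) x) +
        b (lt (sharp (tau r) a) x) + a (lt (sharp r b) x) + a (lt (sharp (tau r) b) x) = 0 := by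
    intro x a b
    have h := pair2_fmap tr lt x (r + tau r) a b
    rw [hf, map_zero] at h
    simp only [tau_add', tau_tau', sharp_add', map_add, LinearMap.add_apply,
      hcomm x] at h
    rw [h]; ring
  have E2 : ∀ a b c : Module.Dual K A,
      c (lt (sharp r a) (sharp r b)) -
        c (sharp r (-(((tr + lt).flip (sharp r a)).dualMap b) -
            ((tr + lt).flip (sharp r b)).dualMap a +
            ((tr + lt).flip (sharp (r + tau r) a)).dualMap b)) =
      - pair3 b c a (SAcal tr lt r) := by
    intro a b c
    rw [pair3_SAcal, sharp_adj r _ c]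
    have h := F (sharp r b) c a
    simp only [sharp_add', map_add, LinearMap.add_apply, LinearMap.sub_apply,
      LinearMap.neg_apply, LinearMap.dualMap_apply, LinearMap.flip_apply,
      hcomm (sharp r b)] at h ⊢
    linear_combination h
  have E1 : ∀ a b c : Module.Dual K A,
      c (tr (sharp r a) (sharp r b)) -
        c (sharp r (((tr + lt) (sharp r a)).dualMap b +
            ((tr + lt).flip (sharp r a)).dualMap b +
            (tr.flip (sharp r b)).dualMap a -
            (((tr + lt) (sharp (r + tau r) a)).dualMap b +
              ((tr + lt).flip (sharp (r + tau r) a)).dualMap b))) =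
      pair3 b a c (SAcal tr lt r) + pair3 b c a (SAcal tr lt r) := by
    intro a b c
    rw [pair3_SAcal, pair3_SAcal, sharp_adj r _ c]
    have h := F (sharp r b) c a
    simp only [sharp_add', map_add, LinearMap.add_apply, LinearMap.sub_apply,
      LinearMap.neg_apply, LinearMap.dualMap_apply, LinearMap.flip_apply,
      hcomm (sharp r b)] at h ⊢
    linear_combination -h
  constructor
  · intro h a b
    simp only [h, map_zero, neg_zero, add_zero] at E1 E2
    constructor
    · rw [← sub_eq_zero, ← Module.forall_dual_apply_eq_zero_iff K]
      intro c
      rw [map_sub, E1]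
    · rw [← sub_eq_zero, ← Module.forall_dual_apply_eq_zero_iff K]
      intro c
      rw [map_sub, E2]
  · intro h
    apply pair3_sep
    intro b c a
    have h2 := E2 a b c
    rw [← (h a b).2, sub_self] at h2
    exact neg_eq_zero.mp h2.symm

end Theorems
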